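/- Let A be a weighted pushdown system with state set Q and stack alphabet Γ, and let π be a finite valid path in A whose additional stack height satisfies ASH(π) = d ≥ (|Q|·|Γ|)². Then π has a pumpable pair of paths, i.e., there exist nonempty consecutive edge segments (p₁,p₂) of π such that for every j ≥ 0 the sequence obtained from π by repeating p₁ and p₂ each j times in place is a valid path. -/

import Mathlib

open scoped BigOperators

namespace PDS

/-- Stack commands over a stack alphabet `Γ`. -/
inductive Com (Γ : Type) where
  | skip : Com Γ
  | pop : Com Γ
  | push (z : Γ) : Com Γ
  deriving DecidableEq

/-- Action of a stack command on a stack string (top of stack at the head). -/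
def Com.apply {Γ : Type} : Com Γ → List Γ → List Γ
  | .skip, α => α
  | .pop, α => α.tail
  | .push z, α => z :: α

/-- A transition (edge) of a pushdown system. -/
structure Edge (Q Γ : Type) where
  q1 : Q
  top : Γ
  q2 : Q
  com : Com Γ
  deriving DecidableEq

/-- A weighted pushdown system. -/
structure WPS (Q Γ : Type) where
  q0 : Q
  bot : Γ
  E : Set (Edge Q Γ)
  w : Edge Q Γ → ℤ
  no_push_bot : ∀ e ∈ E, e.com ≠ Com.push bot
  no_pop_bot : ∀ e ∈ E, e.top = bot → e.com ≠ Com.pop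

variable {Q Γ : Type}

/-- A configuration: stack string (top at head) together with a state. -/
abbrev Config (Q Γ : Type) := List Γ × Q

/-- A genuine configuration has a nonempty stack string. -/
def IsConfig (c : Config Q Γ) : Prop := c.1 ≠ []

/-- The initial configuration `(⊥, q₀)`. -/
def WPS.start (A : WPS Q Γ) : Config Q Γ := ([A.bot], A.q0)

/-- The configuration obtained by taking the edge `e` from `c`. -/
def next (c : Config Q Γ) (e : Edge Q Γ) : Config Q Γ := (e.com.apply c.1, e.q2)

/-- The edge `e` is enabled at configuration `c`. -/
def WPS.Enabled (A : WPS Q Γ) (c : Config Q Γ) (e : Edge Q Γ) : Prop :=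
  e ∈ A.E ∧ c.2 = e.q1 ∧ c.1.head? = some e.top

/-- Validity of a finite path, given by a start configuration and a list of edges. -/
def WPS.Valid (A : WPS Q Γ) : Config Q Γ → List (Edge Q Γ) → Prop
  | _, [] => True
  | c, e :: es => A.Enabled c e ∧ A.Valid (next c e) es

/-- Last configuration of the finite path `(c, es)`. -/
def endc (c : Config Q Γ) (es : List (Edge Q Γ)) : Config Q Γ := es.foldl next c

/-- The list of configurations along the finite path `(c, es)`. -/
def trace (c : Config Q Γ) (es : List (Edge Q Γ)) : List (Config Q Γ) :=
  List.scanl next c es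

/-- Total weight of a finite path. -/
def WPS.wt (A : WPS Q Γ) (es : List (Edge Q Γ)) : ℤ := (es.map A.w).sum

/-- Stack height of a configuration. -/
def height (c : Config Q Γ) : ℕ := c.1.length

/-- Stack height of a finite path: maximal stack height along it. -/
def SH (c : Config Q Γ) (es : List (Edge Q Γ)) : ℕ :=
  ((trace c es).map height).foldr max 0

/-- Additional stack height of a finite path. -/
def ASH (c : Config Q Γ) (es : List (Edge Q Γ)) : ℕ :=
  SH c es - max (height c) (height (endc c es))

/-- The first configuration of the path is a local minima: its stack string is a
prefix (here: suffix of the list, since the top is at the head) of all stack strings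
along the path. -/
def FirstMin (c : Config Q Γ) (es : List (Edge Q Γ)) : Prop :=
  ∀ c' ∈ trace c es, c.1 <:+ c'.1

/-- The edge sequence obtained from `u ++ p₁ ++ v ++ p₂ ++ x` by repeating `p₁` and
`p₂` each `j` times in place. -/
def pumped (u p₁ v p₂ x : List (Edge Q Γ)) (j : ℕ) : List (Edge Q Γ) :=
  u ++ (List.replicate j p₁).flatten ++ v ++ (List.replicate j p₂).flatten ++ x

/-- `(p₁, p₂)` is a pumpable pair of paths for the path `(c, es)`. -/
def WPS.PumpablePair (A : WPS Q Γ) (c : Config Q Γ) (es p₁ p₂ : List (Edge Q Γ)) : Prop :=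
  p₁ ≠ [] ∧ p₂ ≠ [] ∧
    ∃ u v x, es = u ++ p₁ ++ v ++ p₂ ++ x ∧
      ∀ j : ℕ, A.Valid c (pumped u p₁ v p₂ x j)

/-- The path `(c, es)` has a pumpable pair of paths. -/
def WPS.HasPumpablePair (A : WPS Q Γ) (c : Config Q Γ) (es : List (Edge Q Γ)) : Prop :=
  ∃ p₁ p₂, A.PumpablePair c es p₁ p₂

/-- `(c, es)` is a good cycle. -/
def WPS.GoodCycle (A : WPS Q Γ) (c : Config Q Γ) (es : List (Edge Q Γ)) : Prop :=
  A.Valid c es ∧ 0 < A.wt es ∧ FirstMin c es ∧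
    (endc c es).2 = c.2 ∧ (endc c es).1.head? = c.1.head?

/-- `A` has a good cycle reachable from the configuration `c`. -/
def WPS.ReachableGoodCycleFrom (A : WPS Q Γ) (c : Config Q Γ) : Prop :=
  ∃ es₀ es, A.Valid c es₀ ∧ A.GoodCycle (endc c es₀) es

/-- `A` has a good cycle (at some configuration). -/
def WPS.HasGoodCycle (A : WPS Q Γ) : Prop :=
  ∃ c es, IsConfig c ∧ A.GoodCycle c es

/-- The finite path `(c, es)` contains a good cycle. -/
def ContainsGoodCycle (A : WPS Q Γ) (c : Config Q Γ) (es : List (Edge Q Γ)) : Prop :=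
  ∃ es₁ es₂, es = es₁ ++ es₂ ∧ A.GoodCycle (endc c es₁) es₂

/-- Configurations along an infinite path given by an infinite edge sequence. -/
def confs (c : Config Q Γ) (f : ℕ → Edge Q Γ) : ℕ → Config Q Γ
  | 0 => c
  | n + 1 => next (confs c f n) (f n)

/-- Validity of the infinite path `(c, f)`. -/
def WPS.ValidInf (A : WPS Q Γ) (c : Config Q Γ) (f : ℕ → Edge Q Γ) : Prop :=
  ∀ n, A.Enabled (confs c f n) (f n)

/-- Average weight of the prefix of length `n+1` of an infinite path. -/
noncomputable def avgPref (A : WPS Q Γ) (f : ℕ → Edge Q Γ) (n : ℕ) : ℝ :=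
  (∑ i ∈ Finset.range (n + 1), (A.w (f i) : ℝ)) / (n + 1)

/-- Limit-sup of the averages along an infinite path. -/
noncomputable def LimSupAvg (A : WPS Q Γ) (f : ℕ → Edge Q Γ) : ℝ :=
  Filter.limsup (avgPref A f) Filter.atTop

/-- Limit-inf of the averages along an infinite path. -/
noncomputable def LimInfAvg (A : WPS Q Γ) (f : ℕ → Edge Q Γ) : ℝ :=
  Filter.liminf (avgPref A f) Filter.atTop

/-- An infinite edge sequence is ultimately periodic. -/
def UltPeriodic (f : ℕ → Edge Q Γ) : Prop :=
  ∃ N p : ℕ, 0 < p ∧ ∀ n, N ≤ n → f (n + p) = f n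

/-- The infinite path `(c, f)` is stack bounded. -/
def StackBounded (c : Config Q Γ) (f : ℕ → Edge Q Γ) : Prop :=
  ∃ n : ℕ, ∀ k, height (confs c f k) ≤ n

/-- Non-decreasing path: a valid path whose first configuration is a local minima. -/
def WPS.NonDec (A : WPS Q Γ) (c : Config Q Γ) (es : List (Edge Q Γ)) : Prop :=
  A.Valid c es ∧ FirstMin c es

/-- Summary function, valued in `EReal`: `⊥` means there is no non-decreasing path
from `(⊥γ,q₁)` to `(⊥γ,q₂)`, `⊤` means `ω` (weights unbounded from above), and
otherwise the value is the maximal weight of such a path. -/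
noncomputable def WPS.summary (A : WPS Q Γ) (q₁ : Q) (γ : Γ) (q₂ : Q) : EReal :=
  sSup { x : EReal | ∃ es, A.NonDec ([γ, A.bot], q₁) es ∧
    endc ([γ, A.bot], q₁) es = ([γ, A.bot], q₂) ∧ x = ((A.wt es : ℝ) : EReal) }

/-- Stack height bounded summary function: as `summary` but only over non-decreasing
paths of additional stack height at most `d`. -/
noncomputable def WPS.summaryBdd (A : WPS Q Γ) (d : ℕ) (q₁ : Q) (γ : Γ) (q₂ : Q) : EReal :=
  sSup { x : EReal | ∃ es, A.NonDec ([γ, A.bot], q₁) es ∧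
    endc ([γ, A.bot], q₁) es = ([γ, A.bot], q₂) ∧ ASH ([γ, A.bot], q₁) es ≤ d ∧
    x = ((A.wt es : ℝ) : EReal) }

/-- Edges of the summary graph `Gr(A)` together with their weights in `EReal`
(`⊤` plays the role of `ω`): skip edges weighted by the summary function and push
edges weighted by the corresponding transition weight. -/
def WPS.GrEdge (A : WPS Q Γ) (v₁ v₂ : Q × Γ) (x : EReal) : Prop :=
  (v₁.2 = v₂.2 ∧ A.summary v₁.1 v₁.2 v₂.1 ≠ ⊥ ∧ x = A.summary v₁.1 v₁.2 v₂.1) ∨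
  (∃ e ∈ A.E, e.q1 = v₁.1 ∧ e.top = v₁.2 ∧ e.q2 = v₂.1 ∧ e.com = Com.push v₂.2 ∧
    x = ((A.w e : ℝ) : EReal))

/-- The summary graph `Gr(A)` has a positive simple cycle: a simple cycle containing
an `ω`-edge or whose total weight is positive. -/
def WPS.PosSimpleCycle (A : WPS Q Γ) : Prop :=
  ∃ (k : ℕ) (v : Fin (k + 1) → Q × Γ) (x : Fin (k + 1) → EReal),
    Function.Injective v ∧ (∀ i, A.GrEdge (v i) (v (i + 1)) (x i)) ∧
    ((∃ i, x i = ⊤) ∨ (0 : EReal) < ∑ i, x i)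

/-- Weight of a finite path under the shifted weight function `w + r`. -/
def WPS.wtQ (A : WPS Q Γ) (r : ℚ) (es : List (Edge Q Γ)) : ℚ :=
  (es.map (fun e => (A.w e : ℚ) + r)).sum

/-- The shifted system `A^r` (weight function `w + r`) has a good cycle. -/
def WPS.GoodCycleShift (A : WPS Q Γ) (r : ℚ) : Prop :=
  ∃ c es, IsConfig c ∧ A.Valid c es ∧ 0 < A.wtQ r es ∧ FirstMin c es ∧
    (endc c es).2 = c.2 ∧ (endc c es).1.head? = c.1.head?

end PDS

namespace PDS

/-- `es` is a valid path from `c` to `c'`. -/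
def WPS.Run {Q Γ : Type} (A : WPS Q Γ) (c : Config Q Γ) (es : List (Edge Q Γ))
    (c' : Config Q Γ) : Prop :=
  A.Valid c es ∧ endc c es = c'

section Runs

variable {Q Γ : Type} {A : WPS Q Γ}

theorem endc_append (c : Config Q Γ) (l₁ l₂ : List (Edge Q Γ)) :
    endc c (l₁ ++ l₂) = endc (endc c l₁) l₂ := by
  simp [endc]

theorem WPS.valid_append {c : Config Q Γ} {l₁ l₂ : List (Edge Q Γ)} :
    A.Valid c (l₁ ++ l₂) ↔ A.Valid c l₁ ∧ A.Valid (endc c l₁) l₂ := by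
  induction l₁ generalizing c with
  | nil => simp [WPS.Valid, endc]
  | cons e l ih => simp [WPS.Valid, endc, ih, and_assoc]

theorem WPS.Run.append {c₁ c₂ c₃ : Config Q Γ} {l₁ l₂ : List (Edge Q Γ)}
    (h₁ : A.Run c₁ l₁ c₂) (h₂ : A.Run c₂ l₂ c₃) : A.Run c₁ (l₁ ++ l₂) c₃ := by
  obtain ⟨hv, rfl⟩ := h₁
  exact ⟨WPS.valid_append.2 ⟨hv, h₂.1⟩, (endc_append _ _ _).trans h₂.2⟩

theorem Com.apply_append (m : Com Γ) {α : List Γ} (hα : α ≠ []) (ρ : List Γ) :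
    m.apply (α ++ ρ) = m.apply α ++ ρ := by
  obtain ⟨x, α, rfl⟩ := List.exists_cons_of_ne_nil hα
  cases m <;> rfl

theorem next_append {α : List Γ} (hα : α ≠ []) (ρ : List Γ) (q : Q) (e : Edge Q Γ) :
    next (α ++ ρ, q) e = ((next (α, q) e).1 ++ ρ, (next (α, q) e).2) := by
  simp [next, Com.apply_append _ hα]

/-- Symbols may be added below the stack of a valid path. -/
theorem WPS.Run.frame {α β : List Γ} {q r : Q} {es : List (Edge Q Γ)}
    (h : A.Run (α, q) es (β, r)) (ρ : List Γ) : A.Run (α ++ ρ, q) es (β ++ ρ, r) := by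
  induction es generalizing α q with
  | nil =>
    obtain ⟨-, h⟩ := h
    simp only [endc, List.foldl_nil, Prod.mk.injEq] at h
    obtain ⟨rfl, rfl⟩ := h
    exact ⟨trivial, rfl⟩
  | cons e es ih =>
    obtain ⟨⟨⟨hE, hq, ht⟩, hv⟩, hend⟩ := h
    have hα : α ≠ [] := by rintro rfl; simp at ht
    obtain ⟨hv', hend'⟩ := ih (α := (next (α, q) e).1) (q := (next (α, q) e).2) ⟨hv, hend⟩
    rw [← next_append hα] at hv' hend'
    refine ⟨⟨⟨hE, hq, ?_⟩, hv'⟩, hend'⟩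
    simp [List.head?_append, show α.head? = some e.top from ht]

/-- Stack symbols that are never exposed along a valid path may be removed. -/
theorem WPS.Run.unframe {α ρ : List Γ} {q : Q} {c : Config Q Γ} {es : List (Edge Q Γ)}
    (h : A.Run (α ++ ρ, q) es c)
    (hh : ∀ l, l <+: es → ρ.length < height (endc (α ++ ρ, q) l)) :
    ∃ β, c.1 = β ++ ρ ∧ A.Run (α, q) es (β, c.2) := by
  induction es generalizing α q with
  | nil =>
    obtain ⟨-, rfl⟩ := h
    exact ⟨α, rfl, trivial, rfl⟩
  | cons e es ih =>
    obtain ⟨⟨⟨hE, hq, ht⟩, hv⟩, hend⟩ := h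
    have hα : α ≠ [] := by
      rintro rfl
      simpa [endc, height] using hh [] List.nil_prefix
    change endc (next (α ++ ρ, q) e) es = c at hend
    have hl : ∀ l, l <+: es → ρ.length < height (endc (next (α ++ ρ, q) e) l) := fun l hl =>
      hh (e :: l) (List.cons_prefix_cons.2 ⟨rfl, hl⟩)
    rw [next_append hα] at hv hend hl
    obtain ⟨β, hβ, hrun⟩ := ih ⟨hv, hend⟩ hl
    refine ⟨β, hβ, ⟨⟨hE, hq, ?_⟩, hrun.1⟩, hrun.2⟩
    obtain ⟨x, α, rfl⟩ := List.exists_cons_of_ne_nil hα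
    exact ht

theorem WPS.Run.pump_up {γ : Γ} {τ : List Γ} {q : Q} {p : List (Edge Q Γ)}
    (h : A.Run ([γ], q) p (γ :: τ, q)) (ρ : List Γ) (j : ℕ) :
    A.Run (γ :: ρ, q) (List.replicate j p).flatten
      (γ :: ((List.replicate j τ).flatten ++ ρ), q) := by
  induction j generalizing ρ with
  | zero => exact ⟨trivial, rfl⟩
  | succ j ih =>
    have := (h.frame ρ).append (ih (τ ++ ρ))
    rw [List.replicate_succ, List.flatten_cons, List.replicate_succ', List.flatten_concat,
      List.append_assoc]
    exact this

theorem WPS.Run.pump_down {γ : Γ} {τ : List Γ} {q : Q} {p : List (Edge Q Γ)}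
    (h : A.Run (γ :: τ, q) p ([γ], q)) (ρ : List Γ) (j : ℕ) :
    A.Run (γ :: ((List.replicate j τ).flatten ++ ρ), q) (List.replicate j p).flatten
      (γ :: ρ, q) := by
  induction j with
  | zero => exact ⟨trivial, rfl⟩
  | succ j ih =>
    have := (h.frame ((List.replicate j τ).flatten ++ ρ)).append ih
    rw [List.replicate_succ, List.flatten_cons, List.replicate_succ, List.flatten_cons,
      List.append_assoc]
    exact this

theorem WPS.Run.valid_pumped {c : Config Q Γ} {γ γ' : Γ} {τ ρ : List Γ} {q q' : Q}
    {u p₁ v p₂ x : List (Edge Q Γ)} (hu : A.Run c u (γ :: ρ, q))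
    (h₁ : A.Run ([γ], q) p₁ (γ :: τ, q)) (hv : A.Run ([γ], q) v ([γ'], q'))
    (h₂ : A.Run (γ' :: τ, q') p₂ ([γ'], q')) (hx : A.Valid (γ' :: ρ, q') x) (j : ℕ) :
    A.Valid c (pumped u p₁ v p₂ x j) :=
  ((((hu.append (h₁.pump_up ρ j)).append (hv.frame _)).append (h₂.pump_down ρ j)).append
    ⟨hx, rfl⟩).1

theorem height_endc_take_succ {c : Config Q Γ} {es : List (Edge Q Γ)} (k : ℕ) :
    height (endc c (es.take (k + 1))) ≤ height (endc c (es.take k)) + 1 ∧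
      height (endc c (es.take k)) ≤ height (endc c (es.take (k + 1))) + 1 := by
  rw [List.take_add_one, endc_append]
  cases es[k]? with
  | none => simp [endc]
  | some e =>
    have : ∀ c : Config Q Γ, height (next c e) ≤ height c + 1 ∧
        height c ≤ height (next c e) + 1 := by
      intro c
      rcases hm : e.com with _ | _ | z <;> simp [next, hm, Com.apply, height] <;> omega
    exact this _

theorem exists_height_eq_SH (c : Config Q Γ) (es : List (Edge Q Γ)) :
    ∃ m ≤ es.length, height (endc c (es.take m)) = SH c es := by
  induction es generalizing c with
  | nil => exact ⟨0, le_rfl, by simp [SH, trace, endc]⟩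
  | cons e es ih =>
    obtain ⟨m, hm, h⟩ := ih (next c e)
    have hSH : SH c (e :: es) = max (height c) (SH (next c e) es) := by
      simp [SH, trace, List.scanl_cons]
    rcases le_total (SH (next c e) es) (height c) with hle | hle
    · exact ⟨0, Nat.zero_le _, by simp [hSH, hle, endc]⟩
    · exact ⟨m + 1, by simpa using hm, by rw [hSH, max_eq_right hle]; exact h⟩

theorem WPS.Valid.run_segment {c : Config Q Γ} {es : List (Edge Q Γ)} (h : A.Valid c es)
    {i j : ℕ} (hij : i ≤ j) :
    A.Run (endc c (es.take i)) ((es.take j).drop i) (endc c (es.take j)) := by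
  have heq : es.take j = es.take i ++ (es.take j).drop i := by
    conv_lhs => rw [← List.take_append_drop i (es.take j), List.take_take, min_eq_left hij]
  rw [← List.take_append_drop j es, WPS.valid_append] at h
  refine ⟨?_, ?_⟩
  · have := h.1
    rw [heq, WPS.valid_append] at this
    exact this.2
  · rw [← endc_append, ← heq]

theorem drop_take_append {α : Type} (l : List α) {i j k : ℕ} (hij : i ≤ j) (hjk : j ≤ k) :
    (l.take j).drop i ++ (l.take k).drop j = (l.take k).drop i := by
  have h : l.take j = (l.take k).take j := by rw [List.take_take, min_eq_left hjk]
  conv_rhs => rw [← List.take_append_drop j (l.take k), ← h]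
  rw [List.drop_append]
  rcases le_or_gt j l.length with hl | hl
  · rw [List.length_take, min_eq_left hl, Nat.sub_eq_zero_of_le hij, List.drop_zero]
  · have hnil : (l.take k).drop j = [] := List.drop_eq_nil_of_le (by simp; omega)
    simp [hnil]

theorem WPS.Valid.unframe_segment {c : Config Q Γ} {es : List (Edge Q Γ)} (h : A.Valid c es)
    {i j : ℕ} (hij : i ≤ j) {γ γ' : Γ} {ρ ρ' : List Γ} {q q' : Q}
    (hi : endc c (es.take i) = (γ :: ρ, q)) (hj : endc c (es.take j) = (γ' :: ρ', q'))
    (hh : ∀ k, i ≤ k → k ≤ j → ρ.length < height (endc c (es.take k))) :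
    ∃ β, γ' :: ρ' = β ++ ρ ∧ A.Run ([γ], q) ((es.take j).drop i) (β, q') := by
  have hrun := h.run_segment hij
  rw [hi, hj] at hrun
  refine WPS.Run.unframe (α := [γ]) hrun fun l hl => ?_
  have hlen : l.length ≤ j - i := hl.length_le.trans (by simp; omega)
  have hl' : l = (es.take (i + l.length)).drop i := by
    conv_lhs => rw [List.prefix_iff_eq_take.1 hl]
    rw [List.take_drop, List.take_take, min_eq_left (by omega)]
  have := (h.run_segment (Nat.le_add_right i l.length)).2
  rw [← hl', hi] at this
  change ρ.length < height (endc (γ :: ρ, q) l)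
  rw [this]
  exact hh _ (by omega) (by omega)

end Runs

/-- The last position before `m` at which a function growing by at most one per step takes
the value `h`. -/
theorem exists_last_crossing {H : ℕ → ℕ} {h : ℕ} (hstep : ∀ k, H (k + 1) ≤ H k + 1)
    (h0 : H 0 ≤ h) (m : ℕ) (hm : h ≤ H m) :
    ∃ a ≤ m, H a = h ∧ ∀ k, a ≤ k → k ≤ m → h ≤ H k := by
  induction m with
  | zero => exact ⟨0, le_rfl, le_antisymm h0 hm, fun k _ hk => by rwa [Nat.le_zero.1 hk]⟩
  | succ m ih =>
    rcases hm.eq_or_lt with heq | hlt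
    · exact ⟨m + 1, le_rfl, heq.symm, fun k h₁ h₂ => by rwa [le_antisymm h₂ h₁]⟩
    · obtain ⟨a, ha, hav, hk⟩ := ih (by have := hstep m; omega)
      refine ⟨a, by omega, hav, fun k h₁ h₂ => ?_⟩
      rcases h₂.eq_or_lt with rfl | h₃
      · exact hm
      · exact hk k h₁ (by omega)

/-- The interval around `m` on which a function changing by at most one per step stays above
a level attained at both of its ends. -/
theorem exists_crossings {H : ℕ → ℕ} {h m n : ℕ}
    (hstep : ∀ k, H (k + 1) ≤ H k + 1 ∧ H k ≤ H (k + 1) + 1)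
    (h0 : H 0 ≤ h) (hn : H n ≤ h) (hmn : m ≤ n) (hm : h ≤ H m) :
    ∃ a b, a ≤ m ∧ m ≤ b ∧ b ≤ n ∧ H a = h ∧ H b = h ∧ ∀ k, a ≤ k → k ≤ b → h ≤ H k := by
  obtain ⟨a, ha, hav, hak⟩ := exists_last_crossing (fun k => (hstep k).1) h0 m hm
  have hrev : ∀ k, H (n - (k + 1)) ≤ H (n - k) + 1 := by
    intro k
    rcases le_or_gt n k with hk | hk
    · rw [Nat.sub_eq_zero_of_le hk, Nat.sub_eq_zero_of_le (by omega)]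
      omega
    · have := (hstep (n - (k + 1))).2
      rwa [show n - (k + 1) + 1 = n - k by omega] at this
  obtain ⟨b, hb, hbv, hbk⟩ := exists_last_crossing (H := fun k => H (n - k)) hrev hn (n - m)
    (by rwa [Nat.sub_sub_self hmn])
  refine ⟨a, n - b, ha, by omega, by omega, hav, hbv, fun k h₁ h₂ => ?_⟩
  rcases le_total k m with hk | hk
  · exact hak k h₁ hk
  · have := hbk (n - k) (by omega) (by omega)
    rwa [Nat.sub_sub_self (by omega)] at this

theorem exists_eq_cons_of_height_pos {Q Γ : Type} {c : Config Q Γ} (h : 0 < height c) :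
    ∃ (p : Q × Γ) (ρ : List Γ), c = (p.2 :: ρ, p.1) := by
  obtain ⟨α, q⟩ := c
  obtain ⟨γ, ρ, rfl⟩ := List.exists_cons_of_length_pos h
  exact ⟨(q, γ), ρ, rfl⟩

/-- Two nested levels with the same states and top symbols at their ends give a pumpable
pair. -/
theorem WPS.Valid.hasPumpablePair {Q Γ : Type} {A : WPS Q Γ} {c : Config Q Γ}
    {es : List (Edge Q Γ)} (hvalid : A.Valid c es) {a a' b' b : ℕ} {γ γ' : Γ} {q q' : Q}
    {ρ ρ' σ σ' : List Γ} (haa : a < a') (hab : a' ≤ b') (hbb : b' < b) (hb : b ≤ es.length)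
    (ha : endc c (es.take a) = (γ :: ρ, q)) (ha' : endc c (es.take a') = (γ :: ρ', q))
    (hb' : endc c (es.take b') = (γ' :: σ', q')) (hbe : endc c (es.take b) = (γ' :: σ, q'))
    (hρσ : σ.length = ρ.length) (hρσ' : σ'.length = ρ'.length)
    (hh : ∀ k, a ≤ k → k ≤ b → ρ.length < height (endc c (es.take k)))
    (hh' : ∀ k, a' ≤ k → k ≤ b' → ρ'.length < height (endc c (es.take k))) :
    A.HasPumpablePair c es := by
  have hsingle : ∀ {β ρ₁ ρ₂ : List Γ}, γ' :: ρ₁ = β ++ ρ₂ → ρ₁.length = ρ₂.length →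
      β = [γ'] ∧ ρ₁ = ρ₂ := by
    intro β ρ₁ ρ₂ h hlen
    have := List.append_inj' (s₁ := [γ']) (t₁ := ρ₁) h hlen
    exact ⟨this.1.symm, this.2⟩
  obtain ⟨β₁, hβ₁, hp₁⟩ := hvalid.unframe_segment haa.le ha ha'
    fun k h₁ h₂ => hh k h₁ (by omega)
  obtain ⟨β₂, hβ₂, hv⟩ := hvalid.unframe_segment hab ha' hb' hh'
  obtain ⟨β₃, hβ₃, hall⟩ := hvalid.unframe_segment (by omega) ha hbe hh
  obtain ⟨rfl, rfl⟩ := hsingle hβ₂ hρσ'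
  obtain ⟨rfl, rfl⟩ := hsingle hβ₃ hρσ
  obtain ⟨τ, rfl⟩ : ∃ τ, β₁ = γ :: τ := by
    have hlt := hh a' haa.le (by omega)
    rw [ha', hβ₁] at hlt
    obtain _ | ⟨x, τ⟩ := β₁
    · simp [height] at hlt
    · simp only [List.cons_append, List.cons.injEq] at hβ₁
      exact ⟨τ, by rw [hβ₁.1]⟩
  have hsplit : (es.take b).drop a =
      ((es.take a').drop a ++ (es.take b').drop a') ++ (es.take b).drop b' := by
    rw [drop_take_append _ haa.le hab, drop_take_append _ (by omega) hbb.le]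
  have hp₂ : A.Run (γ' :: τ, q') ((es.take b).drop b') ([γ'], q') := by
    have h₁ := hp₁.append (hv.frame τ)
    obtain ⟨hv₃, he₃⟩ := hall
    rw [hsplit, WPS.valid_append] at hv₃
    rw [hsplit, endc_append] at he₃
    rw [h₁.2] at he₃ hv₃
    exact ⟨hv₃.2, he₃⟩
  have hx := hvalid
  rw [← List.take_append_drop b es, WPS.valid_append, hbe] at hx
  have hu := hvalid.run_segment (Nat.zero_le a)
  rw [ha] at hu
  refine ⟨(es.take a').drop a, (es.take b).drop b', ?_, ?_,
    es.take a, (es.take b').drop a', es.drop b, ?_,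
    WPS.Run.valid_pumped hu hp₁ hv hp₂ hx.2⟩
  · refine List.ne_nil_of_length_pos ?_
    simp
    omega
  · refine List.ne_nil_of_length_pos ?_
    simp
    omega
  · rw [List.append_assoc (es.take a), List.append_assoc (es.take a), ← hsplit]
    have := drop_take_append es (Nat.zero_le a) (show a ≤ b by omega)
    rw [List.drop_zero, List.drop_zero] at this
    rw [this, List.take_append_drop]

end PDS

open PDS in
/-- every valid finite path whose additional stack height is at least
`(|Q|·|Γ|)²` has a pumpable pair of paths. -/
theorem every_deep_path_has_a_pumpable_pair
    {Q Γ : Type} [Fintype Q] [Fintype Γ]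
    (A : WPS Q Γ) (c : Config Q Γ) (es : List (Edge Q Γ)) (d : ℕ)
    (hc : IsConfig c) (hvalid : A.Valid c es)
    (hASH : ASH c es = d)
    (hd : (Fintype.card Q * Fintype.card Γ) ^ 2 ≤ d) :
    A.HasPumpablePair c es := by
  obtain ⟨m, hm, hpeak⟩ := exists_height_eq_SH c es
  set M := max (height c) (height (endc c es)) with hM
  have hMpos : 0 < M := lt_max_of_lt_left (List.length_pos_of_ne_nil hc)
  have hpos : 0 < (Fintype.card Q * Fintype.card Γ) ^ 2 := by
    have : Nonempty Q := ⟨c.2⟩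
    have : Nonempty Γ := ⟨c.1.head hc⟩
    exact pow_pos (Nat.mul_pos Fintype.card_pos Fintype.card_pos) 2
  have hlevel : ∀ i : Fin ((Fintype.card Q * Fintype.card Γ) ^ 2 + 1),
      ∃ (a b : ℕ) (p : (Q × Γ) × (Q × Γ)) (ρ σ : List Γ), a ≤ m ∧ m ≤ b ∧ b ≤ es.length ∧
        endc c (es.take a) = (p.1.2 :: ρ, p.1.1) ∧ endc c (es.take b) = (p.2.2 :: σ, p.2.1) ∧
        ρ.length + 1 = M + i ∧ σ.length + 1 = M + i ∧
        ∀ k, a ≤ k → k ≤ b → M + i ≤ height (endc c (es.take k)) := by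
    intro i
    have hi := i.2
    obtain ⟨a, b, ha, hb, hbn, hav, hbv, hk⟩ :=
      exists_crossings (H := fun k => height (endc c (es.take k))) (h := M + i) (m := m)
        (n := es.length) height_endc_take_succ
        (le_add_right (le_max_left _ _))
        (by rw [List.take_length]; exact le_add_right (le_max_right _ _)) hm
        (by
          rw [← hASH, ASH, ← hM] at hd
          omega)
    obtain ⟨p, ρ, hp⟩ := exists_eq_cons_of_height_pos (c := endc c (es.take a)) (by omega)
    obtain ⟨r, σ, hr⟩ := exists_eq_cons_of_height_pos (c := endc c (es.take b)) (by omega)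
    refine ⟨a, b, (p, r), ρ, σ, ha, hb, hbn, hp, hr, ?_, ?_, hk⟩
    · rw [hp] at hav
      exact hav
    · rw [hr] at hbv
      exact hbv
  choose a b p ρ σ ham hmb hbn ha hb hρ hσ hk using hlevel
  obtain ⟨i, j, hij, hpij⟩ : ∃ i j, i < j ∧ p i = p j := by
    obtain ⟨i, j, hne, h⟩ := Fintype.exists_ne_map_eq_of_card_lt p (by
      simp only [Fintype.card_prod, Fintype.card_fin]
      rw [← sq]
      exact Nat.lt_succ_self _)
    rcases lt_or_gt_of_ne hne with hlt | hlt
    · exact ⟨i, j, hlt, h⟩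
    · exact ⟨j, i, hlt, h.symm⟩
  have hij' : (i : ℕ) < j := hij
  have hai : height (endc c (es.take (a i))) = M + i := by rw [ha, ← hρ]; rfl
  have hbi : height (endc c (es.take (b i))) = M + i := by rw [hb, ← hσ]; rfl
  have haa : a i < a j := by
    by_contra! h
    have := hk j (a i) h ((ham i).trans (hmb j))
    omega
  have hbb : b j < b i := by
    by_contra! h
    have := hk j (b i) ((ham j).trans (hmb i)) h
    omega
  have haj := ha j
  have hbj := hb j
  rw [← hpij] at haj hbj
  refine hvalid.hasPumpablePair haa ((ham j).trans (hmb j)) hbb (hbn i) (ha i) haj hbj (hb i)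
    ?_ ?_ (fun k h₁ h₂ => ?_) (fun k h₁ h₂ => ?_)
  · have := hρ i; have := hσ i; omega
  · have := hρ j; have := hσ j; omega
  · have := hk i k h₁ h₂; have := hρ i; omega
  · have := hk j k h₁ h₂; have := hρ j; omega
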